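/- Projection–update introduction (Figure 8, axiom 11): Let V be a type with decidable equality on ℕ indices, and model tuples as functions ℕ → V, relations as lists A, B : List (ℕ → V). Let L, L' : List ℕ be attribute lists with L.Nodup and L'.Nodup, let j be an index with j < L.length and j < L'.length, and let v : V. If A.map (fun r => L.map r) = B.map (fun r => L'.map r), then updating the j-th projected attribute to v on both sides preserves equality of projections: A.map (fun r => L.map (Function.update r (L.get ⟨j, _⟩) v)) = B.map (fun r => L'.map (Function.update r (L'.get ⟨j, _⟩) v)). -/

import Mathlib

/-- Mapping a function updated at the `j`-th entry of a duplicate-free list sets the `j`-th entry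
of the image. -/
theorem List.Nodup.map_update_get {α β : Type*} [DecidableEq α] {l : List α} (hl : l.Nodup)
    (f : α → β) (j : Fin l.length) (y : β) :
    l.map (Function.update f (l.get j) y) = (l.map f).set j y := by
  rw [hl.map_update, if_pos (l.get_mem j), List.get_eq_getElem, hl.idxOf_getElem]

/-- Projection–update introduction (Figure 8, axiom 11). -/
theorem proj_update_intro {V : Type*} (A B : List (ℕ → V))
    (L L' : List ℕ) (hL : L.Nodup) (hL' : L'.Nodup)
    (j : ℕ) (hj : j < L.length) (hj' : j < L'.length) (v : V)
    (h : A.map (fun r => L.map r) = B.map (fun r => L'.map r)) :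
    A.map (fun r => L.map (Function.update r (L.get ⟨j, hj⟩) v)) =
      B.map (fun r => L'.map (Function.update r (L'.get ⟨j, hj'⟩) v)) := by
  simp only [hL.map_update_get, hL'.map_update_get]
  simpa only [List.map_map, Function.comp_def] using
    congrArg (List.map fun t => t.set j v) h
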